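/- Let 0 ≤ m ≤ n be integers, a > 0, and Q ∈ Π_n^m with ‖Q‖ = 1. Then ‖Q − Σ_{k=−n}^n Σ_{i : x_{|k|,i} < −1+a} ⟨Q, ψ_{k,i}⟩ ψ_{k,i}‖² ≤ (1 + ε(Q))/a. -/

import Mathlib

open MeasureTheory Finset

noncomputable section

namespace SFT

/-- The recurrence coefficients `b_l^{(α)}` of the orthonormal ultraspherical polynomials. -/
def b (α : ℝ) : ℕ → ℝ
  | 0 => Real.sqrt (Real.sqrt Real.pi * Real.Gamma (α + 1) / (2 * Real.Gamma (α + 3 / 2)))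
  | l + 1 => Real.sqrt ((((l : ℝ) + 1) * (((l : ℝ) + 1) + 2 * α)) /
      ((2 * ((l : ℝ) + 1) + 2 * α + 1) * (2 * ((l : ℝ) + 1) + 2 * α - 1)))

/-- The associated ultraspherical polynomials: `pA α m l x = p_l^{(α)}(x, m)`.
For `m = 0` these are the orthonormal ultraspherical polynomials `p_l^{(α)}(x)`. -/
def pA (α : ℝ) (m : ℕ) : ℕ → ℝ → ℝ
  | 0, _ => 1 / b α m
  | 1, x => x * (1 / b α m) / b α (m + 1)
  | l + 2, x => (x * pA α m (l + 1) x - b α (m + l + 1) * pA α m l x) / b α (m + l + 2)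

/-- The orthonormal ultraspherical polynomials `p_l^{(α)}(x)`. -/
def p (α : ℝ) (l : ℕ) (x : ℝ) : ℝ := pA α 0 l x

/-- Ultraspherical polynomials with integer index; in particular `p_{-1}^{(α)} = 0`. -/
def pZ (α : ℝ) (l : ℤ) (x : ℝ) : ℝ := if 0 ≤ l then p α l.toNat x else 0

/-- `JE α M i j` is the `(i,j)` entry (`0`-based) of the truncated Jacobi matrix
`J(α)_L^M` (of any size `L − M + 1`). -/
def JE (α : ℝ) (M : ℕ) (i j : ℕ) : ℝ :=
  if i + 1 = j then b α (M + i + 1) else if j + 1 = i then b α (M + j + 1) else 0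

/-- The truncated Jacobi matrix `J(α)_{M+l}^M`, of size `(l+1) × (l+1)`.
In particular `Jt α 0 l` is the Jacobi matrix `J(α)_l`. -/
def Jt (α : ℝ) (M l : ℕ) : Matrix (Fin (l + 1)) (Fin (l + 1)) ℝ :=
  fun i j => JE α M i.1 j.1

/-- The spherical harmonics `Y_l^k(θ, φ)`. -/
def Y (l : ℕ) (k : ℤ) (θ φ : ℝ) : ℂ :=
  ((Real.sin θ ^ k.natAbs : ℝ) : ℂ) * ((p (k.natAbs : ℝ) (l - k.natAbs) (Real.cos θ) : ℝ) : ℂ) *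
    Complex.exp (Complex.I * (k : ℂ) * (φ : ℂ))

/-- Parameter region `[0, π] × [0, 2π]` of spherical coordinates. -/
def region : Set (ℝ × ℝ) := Set.Icc (0 : ℝ) Real.pi ×ˢ Set.Icc (0 : ℝ) (2 * Real.pi)

/-- The inner product of `L²(S²)`. -/
def inner2 (f g : ℝ → ℝ → ℂ) : ℂ :=
  (1 / (4 * Real.pi)) *
    ∫ q in region, f q.1 q.2 * (starRingEnd ℂ) (g q.1 q.2) * ((Real.sin q.1 : ℝ) : ℂ)

/-- The norm of `L²(S²)`. -/
def norm2 (f : ℝ → ℝ → ℂ) : ℝ := Real.sqrt (inner2 f f).re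

/-- Membership in `L²(S²)`. -/
def MemL2 (f : ℝ → ℝ → ℂ) : Prop :=
  Measurable (fun q : ℝ × ℝ => f q.1 q.2) ∧
    IntegrableOn (fun q : ℝ × ℝ => ‖f q.1 q.2‖ ^ 2 * Real.sin q.1) region

/-- The multiplication operator `M`. -/
def Mop (f : ℝ → ℝ → ℂ) : ℝ → ℝ → ℂ := fun θ φ => ((Real.cos θ : ℝ) : ℂ) * f θ φ

/-- The power `M^j` of the multiplication operator. -/
def Mpow (j : ℕ) (f : ℝ → ℝ → ℂ) : ℝ → ℝ → ℂ := fun θ φ => ((Real.cos θ : ℝ) : ℂ) ^ j * f θ φ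

/-- The mean value `ε(f)`. -/
def eps (f : ℝ → ℝ → ℂ) : ℝ :=
  (1 / (4 * Real.pi)) * ∫ q in region, Real.cos q.1 * ‖f q.1 q.2‖ ^ 2 * Real.sin q.1

/-- The projection `P_n^m` onto `Π_n^m`. -/
def Pr (n m : ℕ) (f : ℝ → ℝ → ℂ) : ℝ → ℝ → ℂ :=
  fun θ φ => ∑ l ∈ Finset.Icc m n, ∑ k ∈ Finset.Icc (-(l : ℤ)) (l : ℤ),
    inner2 f (Y l k) * Y l k θ φ

/-- The space–frequency operator `P_n^m M P_n^m`. -/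
def SFop (n m : ℕ) (f : ℝ → ℝ → ℂ) : ℝ → ℝ → ℂ := Pr n m (Mop (Pr n m f))

/-- The space `Π_n^m`, spanned by the spherical harmonics `Y_l^k`, `m ≤ l ≤ n`, `|k| ≤ l`. -/
def Pi_nm (n m : ℕ) : Submodule ℂ (ℝ → ℝ → ℂ) :=
  Submodule.span ℂ {g | ∃ l : ℕ, ∃ k : ℤ, m ≤ l ∧ l ≤ n ∧ k.natAbs ≤ l ∧ g = Y l k}

/-- `N_k = n − max(|k|, m) + 1`. -/
def Nk (n m k : ℕ) : ℕ := n - max k m + 1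

/-- The normalizing constant `κ_{k,i}`, given the corresponding root value `xr`. -/
def kap (n m k : ℕ) (xr : ℝ) : ℝ :=
  (Real.sqrt (∑ l ∈ Finset.Icc (max k m) n, (pA (k : ℝ) (m - k) (l - max k m) xr) ^ 2))⁻¹

/-- The eigenfunction `ψ_{k,i}`, given the corresponding root value `xr`. -/
def psiFun (n m : ℕ) (k : ℤ) (xr : ℝ) : ℝ → ℝ → ℂ :=
  fun θ φ => ((kap n m k.natAbs xr : ℝ) : ℂ) *
    ∑ l ∈ Finset.Icc (max k.natAbs m) n,
      ((pA (k.natAbs : ℝ) (m - k.natAbs) (l - max k.natAbs m) xr : ℝ) : ℂ) * Y l k θ φ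

lemma b_succ_sq (k l : ℕ) : b (k:ℝ) (l+1) ^ 2 = (((l : ℝ) + 1) * (((l : ℝ) + 1) + 2 * k)) /
      ((2 * ((l : ℝ) + 1) + 2 * k + 1) * (2 * ((l : ℝ) + 1) + 2 * k - 1)) := by
  rw [b, Real.sq_sqrt]
  have h : (0:ℝ) ≤ 2 * ((l : ℝ) + 1) + 2 * k - 1 := by
    have : (0:ℝ) ≤ l := by positivity
    have : (0:ℝ) ≤ k := by positivity
    linarith
  positivity

lemma b_pos (k l : ℕ) : 0 < b (k:ℝ) l := by
  cases l with
  | zero =>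
    rw [b]
    apply Real.sqrt_pos.2
    have h1 : 0 < Real.Gamma ((k:ℝ) + 1) := Real.Gamma_pos_of_pos (by positivity)
    have h2 : 0 < Real.Gamma ((k:ℝ) + 3/2) := Real.Gamma_pos_of_pos (by positivity)
    positivity
  | succ l =>
    rw [b]
    apply Real.sqrt_pos.2
    have h : (0:ℝ) < 2 * ((l : ℝ) + 1) + 2 * k - 1 := by
      have : (0:ℝ) ≤ l := by positivity
      have : (0:ℝ) ≤ k := by positivity
      linarith
    positivity

lemma pA_one (k M : ℕ) (x : ℝ) : b k (M+1) * pA k M 1 x = x * pA k M 0 x := by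
  have := (b_pos k (M+1)).ne'
  simp only [pA]; field_simp

lemma pA_rec (k M l : ℕ) (x : ℝ) : b k (M+l+2) * pA k M (l+2) x
    = x * pA k M (l+1) x - b k (M+l+1) * pA k M l x := by
  have := (b_pos k (M+l+2)).ne'
  rw [pA]; field_simp

lemma p_one (k : ℕ) (x : ℝ) : b k 1 * p k 1 x = x * p k 0 x := by
  have := pA_one k 0 x
  simpa [p] using this

lemma p_rec (k l : ℕ) (x : ℝ) : b k (l+2) * p k (l+2) x
    = x * p k (l+1) x - b k (l+1) * p k l x := by
  have := pA_rec k 0 l x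
  simpa [p] using this

/-- derivative of `p` -/
def dp (k : ℕ) : ℕ → ℝ → ℝ
  | 0, _ => 0
  | 1, _ => (1 / b k 0) / b k 1
  | l + 2, x => (p k (l+1) x + x * dp k (l + 1) x - b k (l + 1) * dp k l x) / b k (l + 2)

lemma hasDeriv_p (k : ℕ) (x : ℝ) : ∀ l, HasDerivAt (p k l) (dp k l x) x
  | 0 => by
    have : p k 0 = fun _ => 1 / b k 0 := by funext x; simp [p, pA]
    rw [this]; exact hasDerivAt_const _ _
  | 1 => by
    have : p k 1 = fun x => x * (1 / b k 0) / b k 1 := by funext x; simp [p, pA]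
    rw [this, dp]
    simpa using ((hasDerivAt_id x).mul_const (1 / b k 0)).div_const (b k 1)
  | l+2 => by
    have h : p k (l+2) = fun x => (x * p k (l+1) x - b k (l+1) * p k l x) / b k (l+2) := by
      funext x
      rw [← p_rec]; have := (b_pos k (l+2)).ne'; field_simp
    rw [h, dp]
    have := (((hasDerivAt_id x).mul (hasDeriv_p k x (l+1))).sub
      ((hasDeriv_p k x l).const_mul (b k (l+1)))).div_const (b k (l+2))
    simpa using this

lemma b_succ_sq' (k l : ℕ) : b (k:ℝ) (l+1) ^ 2 * (2*l+2*k+3) * (2*l+2*k+1) = (l+1)*(l+1+2*k) := by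
  rw [b_succ_sq, show 2 * ((l:ℝ)+1) + 2 * k - 1 = 2 * l + 2 * k + 1 by ring,
    show 2 * ((l:ℝ)+1) + 2 * k + 1 = 2 * l + 2 * k + 3 by ring]
  field_simp

/-- `b_l p_{l-1}` -/
def qq (k : ℕ) : ℕ → ℝ → ℝ
  | 0, _ => 0
  | l + 1, x => b k (l+1) * p k l x

lemma p_rec' (k l : ℕ) (x : ℝ) : b k (l+1) * p k (l+1) x = x * p k l x - qq k l x := by
  cases l with
  | zero => simpa [qq] using p_one k x
  | succ l => simpa [qq] using p_rec k l x

lemma structure_rel (k : ℕ) (x : ℝ) : ∀ l, (1 - x^2) * dp k l x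
    = -l * x * p k l x + (2*l+2*k+1) * qq k l x
  | 0 => by simp [dp, qq]
  | 1 => by
    have h1 := (b_pos k 1).ne'
    have h0 := (b_pos k 0).ne'
    have hs := b_succ_sq' k 0
    have hk : (2 * (k:ℝ) + 1) ≠ 0 := by positivity
    have hs' : b k 1 ^ 2 * (2 * k + 3) = 1 := by
      apply mul_right_cancel₀ hk
      push_cast at hs
      linear_combination hs
    have e0 : p k 0 x = 1 / b k 0 := by simp [p, pA]
    have e1 : p k 1 x = x * (1 / b k 0) / b k 1 := by simp [p, pA]
    rw [dp, qq, e1, e0]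
    field_simp
    push_cast
    linear_combination -hs'
  | l+2 => by
    have h2 := (b_pos k (l+2)).ne'
    have S1 := structure_rel k x (l+1)
    have S0 := structure_rel k x l
    have r0 := p_rec' k l x
    have r1 := p_rec k l x
    have hd : b k (l+2) * dp k (l+2) x = p k (l+1) x + x * dp k (l+1) x - b k (l+1) * dp k l x := by
      rw [dp]; field_simp
    have hb1 := b_succ_sq' k l
    have hb2 := b_succ_sq' k (l+1)
    have hD : (2 * (l:ℝ) + 2 * k + 3) ≠ 0 := by positivity
    apply mul_left_cancel₀ h2
    apply mul_left_cancel₀ hD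
    simp only [show ∀ j, qq k (j+1) x = b k (j+1) * p k j x from fun _ => rfl] at S1 ⊢
    push_cast at *
    linear_combination (2 * (l:ℝ) + 2 * k + 3) * ((1-x^2) * hd + x * S1 - b k (l+1) * S0
      + (l+2) * x * r1 - (2*l+2*k+1) * b k (l+1) * r0) + p k (l+1) x * (hb1 - hb2)

/-- the weighted integral -/
def A (k : ℕ) (f : ℝ → ℝ) : ℝ := ∫ t in (0:ℝ)..Real.pi, Real.sin t ^ (2*k+1) * f (Real.cos t)

@[fun_prop]
lemma cont_p (k l : ℕ) : Continuous (p k l) :=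
  continuous_iff_continuousAt.2 fun x => (hasDeriv_p k x l).continuousAt

@[fun_prop]
lemma cont_q (k l : ℕ) : Continuous (qq k l) := by
  cases l with
  | zero => exact continuous_const
  | succ l => exact continuous_const.mul (cont_p k l)

lemma A_add (k : ℕ) (f g : ℝ → ℝ) (hf : Continuous f) (hg : Continuous g) :
    A k (fun x => f x + g x) = A k f + A k g := by
  unfold A
  rw [← intervalIntegral.integral_add]
  · congr 1; funext t; ring
  · exact (by fun_prop : Continuous _).intervalIntegrable _ _
  · exact (by fun_prop : Continuous _).intervalIntegrable _ _

lemma A_smul (k : ℕ) (c : ℝ) (f : ℝ → ℝ) : A k (fun x => c * f x) = c * A k f := by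
  unfold A
  rw [← intervalIntegral.integral_const_mul]
  congr 1; funext t; ring

lemma A_xp (k l : ℕ) : (l + 2*k+2) * A k (fun x => x * p k l x) = (2*l+2*k+1) * A k (qq k l) := by
  have hder : ∀ t ∈ Set.uIcc 0 Real.pi, HasDerivAt (fun t => Real.sin t ^ (2*k+2) * p k l (Real.cos t))
      (Real.sin t ^ (2*k+1) * ((l + 2*k+2) * (Real.cos t * p k l (Real.cos t)) +
        (-(2*l+2*k+1)) * (qq k l (Real.cos t)))) t := by
    intro t _
    have h1 := (Real.hasDerivAt_sin t).pow (2*k+2)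
    have h2 := (hasDeriv_p k (Real.cos t) l).comp t (Real.hasDerivAt_cos t)
    have h3 := h1.mul h2
    refine h3.congr_deriv ?_
    have S := structure_rel k (Real.cos t) l
    have hs : Real.sin t ^ 2 = 1 - Real.cos t ^ 2 := Real.sin_sq t
    simp only [Function.comp, Pi.pow_apply]
    rw [← hs] at S
    push_cast
    linear_combination (-Real.sin t ^ (2*k+1)) * S
  have := intervalIntegral.integral_eq_sub_of_hasDerivAt hder
    ((by fun_prop : Continuous _).intervalIntegrable _ _)
  have e : A k (fun x => (l + 2*k+2) * (x * p k l x) + (-(2*l+2*k+1)) * (qq k l x)) = 0 := by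
    unfold A; rw [this]; simp
  rw [A_add _ _ _ (by fun_prop) (by fun_prop), A_smul, A_smul] at e
  linarith

lemma A_p (k : ℕ) : ∀ l, A k (p k (l+1)) = 0
  | 0 => by
    have h := A_xp k 0
    have h1 : A k (qq k 0) = 0 := by simp [A, qq]
    have h2 : A k (fun x => b k 1 * p k 1 x) = A k (fun x => x * p k 0 x) := by
      congr 1; funext x; exact p_one k x
    rw [A_smul] at h2
    rw [← h2, h1] at h
    have hb := (b_pos k 1).ne'
    have hk : (((0:ℕ):ℝ) + 2 * (k:ℝ) + 2) ≠ 0 := by positivity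
    rw [mul_zero] at h
    exact (mul_eq_zero.1 ((mul_eq_zero.1 h).resolve_left hk)).resolve_left hb
  | 1 => by
    have h := A_xp k 1
    have h2 : A k (fun x => b k 2 * p k 2 x + b k 1 * p k 0 x) = A k (fun x => x * p k 1 x) := by
      congr 1; funext x; have := p_rec k 0 x; simp only [zero_add] at this; rw [this]; ring
    rw [A_add _ _ _ (by fun_prop) (by fun_prop), A_smul, A_smul] at h2
    have h3 : A k (qq k 1) = b k 1 * A k (p k 0) := by
      rw [← A_smul]; rfl
    have hb := (b_pos k 2).ne'
    have hk : (1 + 2 * (k:ℝ) + 2) ≠ 0 := by positivity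
    have : (1 + 2 * (k:ℝ) + 2) * (b k 2 * A k (p k 2)) = 0 := by
      rw [← h2, h3] at h; push_cast at h
      linear_combination h
    simpa [hb, hk] using this
  | l+2 => by
    have h := A_xp k (l+2)
    have h2 : A k (fun x => b k (l+3) * p k (l+3) x + b k (l+2) * p k (l+1) x)
        = A k (fun x => x * p k (l+2) x) := by
      congr 1; funext x; have := p_rec k (l+1) x; rw [this]; ring
    rw [A_add _ _ _ (by fun_prop) (by fun_prop), A_smul, A_smul] at h2
    have h3 : A k (qq k (l+2)) = b k (l+2) * A k (p k (l+1)) := by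
      rw [← A_smul]; rfl
    rw [← h2, h3, A_p k l] at h
    have hb := (b_pos k (l+3)).ne'
    have hk : (((l+2:ℕ):ℝ) + 2 * (k:ℝ) + 2) ≠ 0 := by positivity
    rw [mul_zero, mul_zero, add_zero] at h
    exact (mul_eq_zero.1 ((mul_eq_zero.1 h).resolve_left hk)).resolve_left hb

lemma A_one (k : ℕ) : A k (fun _ => 1) = 2 * b k 0 ^ 2 := by
  have hb : 2 * b k 0 ^ 2 = Real.sqrt Real.pi * Real.Gamma ((k:ℝ) + 1) / Real.Gamma ((k:ℝ) + 3 / 2) := by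
    have h1 : 0 < Real.Gamma ((k:ℝ) + 1) := Real.Gamma_pos_of_pos (by positivity)
    have h2 : 0 < Real.Gamma ((k:ℝ) + 3/2) := Real.Gamma_pos_of_pos (by positivity)
    rw [b, Real.sq_sqrt (by positivity)]
    field_simp
  rw [hb]
  clear hb
  unfold A
  simp only [mul_one]
  induction k with
  | zero =>
    have : Real.Gamma (3/2) = 1/2 * Real.sqrt Real.pi := by
      rw [show (3/2:ℝ) = 1/2 + 1 by norm_num, Real.Gamma_add_one (by norm_num), Real.Gamma_one_half_eq]
    have hp : Real.sqrt Real.pi ≠ 0 := by positivity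
    simp [this]
    field_simp; norm_num
  | succ k ih =>
    have h1 : 0 < Real.Gamma ((k:ℝ) + 1) := Real.Gamma_pos_of_pos (by positivity)
    have h2 : 0 < Real.Gamma ((k:ℝ) + 3/2) := Real.Gamma_pos_of_pos (by positivity)
    rw [show 2 * (k+1) + 1 = (2*k+1) + 2 by ring, integral_sin_pow, ih]
    push_cast
    rw [show (k:ℝ) + 1 + 3/2 = (k + 3/2) + 1 by ring, Real.Gamma_add_one (s := (k:ℝ) + 3/2) (by positivity),
      Real.Gamma_add_one (s := (k:ℝ) + 1) (by positivity)]
    simp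
    field_simp
    ring

lemma A_orth (k : ℕ) : ∀ j i, A k (fun x => p k i x * p k j x) = if i = j then 2 else 0
  | 0, i => by
    have e : A k (fun x => p k i x * p k 0 x) = (1 / b k 0) * A k (p k i) := by
      rw [← A_smul]; congr 1; funext x; simp [p, pA]; ring
    rw [e]
    cases i with
    | zero =>
      have : A k (p k 0) = (1 / b k 0) * A k (fun _ => 1) := by
        rw [← A_smul]; congr 1; funext x; simp [p, pA]
      rw [this, A_one]
      have := (b_pos k 0).ne'
      simp; field_simp
    | succ i => rw [A_p]; simp
  | 1, i => by
    have hb := (b_pos k 1).ne'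
    apply mul_left_cancel₀ hb
    rw [← A_smul]
    cases i with
    | zero =>
      have e : (fun x => b k 1 * (p k 0 x * p k 1 x)) = fun x => b k 1 * (p k 1 x * p k 0 x) := by
        funext x; ring
      rw [e, A_smul, A_orth k 0 1]; simp
    | succ i =>
      have e : (fun x => b k 1 * (p k (i+1) x * p k 1 x)) =
          fun x => b k (i+2) * (p k (i+2) x * p k 0 x) + b k (i+1) * (p k i x * p k 0 x) := by
        funext x
        linear_combination (p k (i+1) x) * p_one k x - p k 0 x * p_rec k i x
      rw [e, A_add _ _ _ (by fun_prop) (by fun_prop), A_smul, A_smul, A_orth k 0 _, A_orth k 0 _]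
      by_cases hi : i = 0
      · subst hi; simp
      · simp [hi]
  | j+2, i => by
    have hb := (b_pos k (j+2)).ne'
    apply mul_left_cancel₀ hb
    rw [← A_smul]
    cases i with
    | zero =>
      have e : (fun x => b k (j+2) * (p k 0 x * p k (j+2) x)) =
          fun x => b k 1 * (p k 1 x * p k (j+1) x) + (-b k (j+1)) * (p k 0 x * p k j x) := by
        funext x
        linear_combination (p k 0 x) * p_rec k j x - p k (j+1) x * p_one k x
      rw [e, A_add _ _ _ (by fun_prop) (by fun_prop), A_smul, A_smul, A_orth k (j+1) _, A_orth k j _]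
      by_cases hj : j = 0
      · subst hj; simp
      · simp [hj, Ne.symm hj]
    | succ i =>
      have e : (fun x => b k (j+2) * (p k (i+1) x * p k (j+2) x)) =
          fun x => (b k (i+2) * (p k (i+2) x * p k (j+1) x) + b k (i+1) * (p k i x * p k (j+1) x))
            + (-b k (j+1)) * (p k (i+1) x * p k j x) := by
        funext x
        linear_combination (p k (i+1) x) * p_rec k j x - p k (j+1) x * p_rec k i x
      rw [e, A_add _ _ _ (by fun_prop) (by fun_prop), A_add _ _ _ (by fun_prop) (by fun_prop), A_smul, A_smul, A_smul,
        A_orth k (j+1) _, A_orth k (j+1) _, A_orth k j _]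
      by_cases h1 : i = j + 1
      · subst h1; simp [show ¬ (j + 1 + 1 = j) by omega]
      · by_cases h2 : i + 1 = j
        · subst h2; simp [show ¬ (i = i + 1 + 1) by omega]
        · simp [h1, h2]

/-- joint continuity -/
def Cont (f : ℝ → ℝ → ℂ) : Prop := Continuous (fun q : ℝ × ℝ => f q.1 q.2)

lemma isCompact_region : IsCompact region := isCompact_Icc.prod isCompact_Icc

lemma intOn {E : Type*} [NormedAddCommGroup E] {F : ℝ × ℝ → E} (hF : Continuous F) : IntegrableOn F region :=
  hF.continuousOn.integrableOn_compact isCompact_region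

lemma inner2_sum_left {ι : Type*} (s : Finset ι) (c : ι → ℂ) (F : ι → ℝ → ℝ → ℂ) (g : ℝ → ℝ → ℂ)
    (hF : ∀ i ∈ s, Cont (F i)) (hg : Cont g) :
    inner2 (fun θ φ => ∑ i ∈ s, c i * F i θ φ) g = ∑ i ∈ s, c i * inner2 (F i) g := by
  unfold inner2
  have : ∀ q : ℝ × ℝ, (∑ i ∈ s, c i * F i q.1 q.2) * (starRingEnd ℂ) (g q.1 q.2) * ((Real.sin q.1 : ℝ) : ℂ)
      = ∑ i ∈ s, c i * (F i q.1 q.2 * (starRingEnd ℂ) (g q.1 q.2) * ((Real.sin q.1 : ℝ) : ℂ)) := by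
    intro q
    rw [Finset.sum_mul, Finset.sum_mul]
    exact Finset.sum_congr rfl fun i _ => by ring
  simp only [this]
  rw [integral_finsetSum]
  · rw [Finset.mul_sum]
    refine Finset.sum_congr rfl fun i _ => ?_
    rw [integral_const_mul]; ring
  · intro i hi
    have h1 : Continuous (fun q : ℝ × ℝ => F i q.1 q.2) := hF i hi
    have h2 : Continuous (fun q : ℝ × ℝ => g q.1 q.2) := hg
    have h3 : Continuous (fun q : ℝ × ℝ => (starRingEnd ℂ) (g q.1 q.2)) := Complex.continuous_conj.comp h2
    exact intOn (by fun_prop)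

lemma inner2_conj (f g : ℝ → ℝ → ℂ) : (starRingEnd ℂ) (inner2 f g) = inner2 g f := by
  unfold inner2
  rw [map_mul, ← integral_conj]
  congr 1
  · simp [map_ofNat]
  · congr 1; funext q
    simp only [map_mul, Complex.conj_conj, Complex.conj_ofReal]
    ring

lemma inner2_sum_right {ι : Type*} (s : Finset ι) (c : ι → ℂ) (F : ι → ℝ → ℝ → ℂ) (g : ℝ → ℝ → ℂ)
    (hF : ∀ i ∈ s, Cont (F i)) (hg : Cont g) :
    inner2 g (fun θ φ => ∑ i ∈ s, c i * F i θ φ) = ∑ i ∈ s, (starRingEnd ℂ) (c i) * inner2 g (F i) := by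
  rw [← inner2_conj, inner2_sum_left s c F g hF hg, map_sum]
  refine Finset.sum_congr rfl fun i _ => ?_
  rw [map_mul, inner2_conj]

lemma inner2_Mop (f g : ℝ → ℝ → ℂ) : inner2 (Mop f) g = inner2 f (Mop g) := by
  unfold inner2 Mop
  congr 2; funext q
  simp only [map_mul, Complex.conj_ofReal]
  ring

lemma eps_eq (f : ℝ → ℝ → ℂ) : ((eps f : ℝ) : ℂ) = inner2 (Mop f) f := by
  unfold eps inner2 Mop
  rw [Complex.ofReal_mul, ← integral_complex_ofReal]
  congr 1
  · push_cast; rfl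
  · congr 1; funext q
    rw [mul_assoc (Complex.ofReal _), Complex.mul_conj, Complex.normSq_eq_norm_sq]
    push_cast; ring

lemma inner2_self (f : ℝ → ℝ → ℂ) : inner2 f f =
    (((1 / (4 * Real.pi)) * ∫ q in region, ‖f q.1 q.2‖ ^ 2 * Real.sin q.1 : ℝ) : ℂ) := by
  unfold inner2
  rw [Complex.ofReal_mul, ← integral_complex_ofReal]
  congr 1
  · push_cast; rfl
  · congr 1; funext q
    rw [Complex.mul_conj, Complex.normSq_eq_norm_sq]
    push_cast; ring

lemma measurableSet_region : MeasurableSet region := isCompact_region.measurableSet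

lemma sin_region {q : ℝ × ℝ} (hq : q ∈ region) : 0 ≤ Real.sin q.1 :=
  Real.sin_nonneg_of_mem_Icc hq.1

lemma inner2_self_re_nonneg (f : ℝ → ℝ → ℂ) : 0 ≤ (inner2 f f).re := by
  rw [inner2_self, Complex.ofReal_re]
  refine mul_nonneg (by positivity) (setIntegral_nonneg measurableSet_region fun q hq => ?_)
  exact mul_nonneg (by positivity) (sin_region hq)

lemma eps_lower (f : ℝ → ℝ → ℂ) (hf : Cont f) : 0 ≤ (inner2 f f).re + eps f := by
  rw [inner2_self, Complex.ofReal_re, eps, ← mul_add]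
  have hf' : Continuous (fun q : ℝ × ℝ => f q.1 q.2) := hf
  rw [← integral_add (intOn (by fun_prop)) (intOn (by fun_prop))]
  refine mul_nonneg (by positivity) (setIntegral_nonneg measurableSet_region fun q hq => ?_)
  have := sin_region hq
  have h1 := Real.neg_one_le_cos q.1
  have : 0 ≤ (1 + Real.cos q.1) * (‖f q.1 q.2‖ ^ 2 * Real.sin q.1) :=
    mul_nonneg (by linarith) (by positivity)
  linarith

/-- spherical harmonics, reindexed -/
def Z (k : ℤ) (s : ℕ) (θ φ : ℝ) : ℂ :=
  ((Real.sin θ ^ k.natAbs : ℝ) : ℂ) * ((p (k.natAbs : ℝ) s (Real.cos θ) : ℝ) : ℂ) *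
    Complex.exp (Complex.I * (k : ℂ) * (φ : ℂ))

lemma Y_eq (l : ℕ) (k : ℤ) : Y l k = Z k (l - k.natAbs) := rfl

lemma cont_Z (k : ℤ) (s : ℕ) : Cont (Z k s) := by
  unfold Cont Z
  fun_prop

lemma int_exp (j : ℤ) : ∫ φ in Set.Icc (0:ℝ) (2 * Real.pi), Complex.exp (Complex.I * (j:ℂ) * (φ:ℂ))
    = if j = 0 then ((2 * Real.pi : ℝ) : ℂ) else 0 := by
  rw [integral_Icc_eq_integral_Ioc, ← intervalIntegral.integral_of_le (by positivity)]
  split_ifs with h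
  · subst h; simp
  · have hc : Complex.I * (j:ℂ) ≠ 0 := mul_ne_zero Complex.I_ne_zero (by exact_mod_cast h)
    rw [integral_exp_mul_complex hc]
    have : Complex.exp (Complex.I * (j:ℂ) * ((2 * Real.pi : ℝ) : ℂ)) = 1 := by
      rw [← Complex.exp_int_mul_two_pi_mul_I j]; congr 1; push_cast; ring
    rw [this]; simp

lemma Z_orth (k k' : ℤ) (s s' : ℕ) : inner2 (Z k s) (Z k' s') = if k = k' ∧ s = s' then 1 else 0 := by
  unfold inner2 region
  have e : ∀ q : ℝ × ℝ, Z k s q.1 q.2 * (starRingEnd ℂ) (Z k' s' q.1 q.2) * ((Real.sin q.1 : ℝ) : ℂ)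
      = ((Real.sin q.1 ^ k.natAbs * p (k.natAbs : ℝ) s (Real.cos q.1) *
        (Real.sin q.1 ^ k'.natAbs * p (k'.natAbs : ℝ) s' (Real.cos q.1)) * Real.sin q.1 : ℝ) : ℂ) *
        Complex.exp (Complex.I * ((k - k' : ℤ) : ℂ) * (q.2 : ℂ)) := by
    intro q
    unfold Z
    simp only [map_mul, Complex.conj_ofReal, ← Complex.exp_conj, Complex.conj_I, map_intCast]
    rw [show Complex.I * ((k - k' : ℤ) : ℂ) * (q.2 : ℂ) = Complex.I * (k : ℂ) * (q.2 : ℂ) +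
      -Complex.I * (k' : ℂ) * (q.2 : ℂ) by push_cast; ring, Complex.exp_add]
    push_cast; ring
  simp only [e]
  rw [Measure.volume_eq_prod, setIntegral_prod_mul (fun θ : ℝ => ((Real.sin θ ^ k.natAbs * p (k.natAbs : ℝ) s (Real.cos θ) *
        (Real.sin θ ^ k'.natAbs * p (k'.natAbs : ℝ) s' (Real.cos θ)) * Real.sin θ : ℝ) : ℂ))
        (fun φ : ℝ => Complex.exp (Complex.I * ((k - k' : ℤ) : ℂ) * (φ : ℂ))), int_exp]
  by_cases hk : k = k'
  · subst hk
    have e2 : ∫ θ in Set.Icc (0:ℝ) Real.pi, ((Real.sin θ ^ k.natAbs * p (k.natAbs : ℝ) s (Real.cos θ) *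
        (Real.sin θ ^ k.natAbs * p (k.natAbs : ℝ) s' (Real.cos θ)) * Real.sin θ : ℝ) : ℂ)
        = ((A k.natAbs (fun x => p k.natAbs s x * p k.natAbs s' x) : ℝ) : ℂ) := by
      rw [integral_complex_ofReal, integral_Icc_eq_integral_Ioc, ← intervalIntegral.integral_of_le (by positivity)]
      unfold A
      congr 2; funext t; ring
    rw [e2, A_orth]
    have hp : (Real.pi : ℂ) ≠ 0 := by exact_mod_cast Real.pi_ne_zero
    by_cases hs : s = s'
    · simp [hs]; field_simp; norm_num
    · simp [hs]
  · have : k - k' ≠ 0 := sub_ne_zero.2 hk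
    simp [hk, this]

/-- `b_s Z_{s-1}` -/
def W (k : ℤ) : ℕ → ℝ → ℝ → ℂ
  | 0 => fun _ _ => 0
  | s + 1 => fun θ φ => (b k.natAbs (s+1) : ℂ) * Z k s θ φ

lemma Mop_Z (k : ℤ) (s : ℕ) (θ φ : ℝ) : (Real.cos θ : ℂ) * Z k s θ φ =
    (b k.natAbs (s+1) : ℂ) * Z k (s+1) θ φ + W k s θ φ := by
  have h := p_rec' k.natAbs s (Real.cos θ)
  have h' : (b k.natAbs (s+1) : ℂ) * (p k.natAbs (s+1) (Real.cos θ) : ℂ) =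
    (Real.cos θ : ℂ) * (p k.natAbs s (Real.cos θ) : ℂ) - (qq k.natAbs s (Real.cos θ) : ℂ) := by
    exact_mod_cast h
  have hW : W k s θ φ = ((Real.sin θ ^ k.natAbs : ℝ) : ℂ) * (qq k.natAbs s (Real.cos θ) : ℂ) *
    Complex.exp (Complex.I * (k : ℂ) * (φ : ℂ)) := by
    cases s with
    | zero => simp [W, qq]
    | succ s => simp only [W, qq, Z]; push_cast; ring
  rw [hW]
  unfold Z
  linear_combination (-((Real.sin θ ^ k.natAbs : ℝ) : ℂ) * Complex.exp (Complex.I * (k : ℂ) * (φ : ℂ))) * h'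

lemma CD (k : ℤ) (M : ℕ) (x : ℝ) (θ φ : ℝ) (N : ℕ) :
    ((Real.cos θ : ℂ) - x) * ∑ j ∈ range (N+1), (pA k.natAbs M j x : ℂ) * Z k (M+j) θ φ =
    (pA k.natAbs M 0 x : ℂ) * W k M θ φ + (b k.natAbs (M+N+1) : ℂ) *
      ((pA k.natAbs M N x : ℂ) * Z k (M+N+1) θ φ - (pA k.natAbs M (N+1) x : ℂ) * Z k (M+N) θ φ) := by
  induction N with
  | zero =>
    have h := pA_one k.natAbs M x
    have h' : (b k.natAbs (M+1) : ℂ) * (pA k.natAbs M 1 x : ℂ) = x * (pA k.natAbs M 0 x : ℂ) := by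
      exact_mod_cast h
    simp only [zero_add, Finset.sum_range_one, add_zero]
    linear_combination (pA k.natAbs M 0 x : ℂ) * Mop_Z k M θ φ + Z k M θ φ * h'
  | succ N ih =>
    have h := pA_rec k.natAbs M N x
    have h' : (b k.natAbs (M+N+2) : ℂ) * (pA k.natAbs M (N+2) x : ℂ) =
        x * (pA k.natAbs M (N+1) x : ℂ) - (b k.natAbs (M+N+1) : ℂ) * (pA k.natAbs M N x : ℂ) := by
      exact_mod_cast h
    rw [Finset.sum_range_succ, mul_add, ih]
    have hM := Mop_Z k (M+(N+1)) θ φ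
    simp only [← add_assoc, W] at hM ⊢
    linear_combination (pA k.natAbs M (N+1) x : ℂ) * hM + Z k (M+N+1) θ φ * h'

lemma inner2_add_left (f f' g : ℝ → ℝ → ℂ) (c c' : ℂ) (hf : Cont f) (hf' : Cont f') (hg : Cont g) :
    inner2 (fun θ φ => c * f θ φ + c' * f' θ φ) g = c * inner2 f g + c' * inner2 f' g := by
  have := inner2_sum_left (univ : Finset (Fin 2)) ![c, c'] ![f, f'] g (by
    intro i _; fin_cases i <;> simpa) hg
  simpa [Fin.sum_univ_two] using this

lemma cont_sum {ι : Type*} (s : Finset ι) (c : ι → ℂ) (F : ι → ℝ → ℝ → ℂ)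
    (hF : ∀ i ∈ s, Cont (F i)) : Cont (fun θ φ => ∑ i ∈ s, c i * F i θ φ) := by
  unfold Cont
  exact continuous_finsetSum _ fun i hi => continuous_const.mul (hF i hi)

lemma cont_Mop {f : ℝ → ℝ → ℂ} (hf : Cont f) : Cont (Mop f) := by
  have hf' : Continuous (fun q : ℝ × ℝ => f q.1 q.2) := hf
  unfold Cont Mop
  fun_prop

lemma abstract_bound {ι : Type*} [DecidableEq ι] (I : Finset ι) (Ψ : ι → ℝ → ℝ → ℂ) (X : ι → ℝ)
    (hc : ∀ i ∈ I, Cont (Ψ i))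
    (ho : ∀ i ∈ I, ∀ j ∈ I, inner2 (Ψ i) (Ψ j) = if i = j then 1 else 0)
    (he : ∀ i ∈ I, ∀ j ∈ I, inner2 (Mop (Ψ i)) (Ψ j) = X i * inner2 (Ψ i) (Ψ j))
    (Q : ℝ → ℝ → ℂ) (c : ι → ℂ) (hQ : Q = fun θ φ => ∑ i ∈ I, c i * Ψ i θ φ) (hn : norm2 Q = 1)
    (a : ℝ) (ha : 0 < a) :
    norm2 (fun θ φ => Q θ φ - ∑ i ∈ I.filter (fun i => X i < -1 + a), inner2 Q (Ψ i) * Ψ i θ φ) ^ 2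
      ≤ (1 + eps Q) / a := by
  have key : ∀ S ⊆ I, inner2 (fun θ φ => ∑ i ∈ S, c i * Ψ i θ φ) (fun θ φ => ∑ i ∈ S, c i * Ψ i θ φ)
      = ((∑ i ∈ S, ‖c i‖ ^ 2 : ℝ) : ℂ) := by
    intro S hS
    rw [inner2_sum_left S c Ψ _ (fun i hi => hc i (hS hi)) (cont_sum S c Ψ (fun i hi => hc i (hS hi)))]
    push_cast
    refine Finset.sum_congr rfl fun i hi => ?_
    rw [inner2_sum_right S c Ψ _ (fun i hi => hc i (hS hi)) (hc i (hS hi)),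
      Finset.sum_congr rfl fun j hj => by rw [ho i (hS hi) j (hS hj)]]
    simp [hi, Complex.mul_conj, Complex.normSq_eq_norm_sq]
  have hcoef : ∀ i ∈ I, inner2 Q (Ψ i) = c i := by
    intro i hi
    rw [hQ, inner2_sum_left I c Ψ _ hc (hc i hi),
      Finset.sum_congr rfl fun j hj => by rw [ho j hj i hi]]
    simp [hi]
  have hdiff : (fun θ φ => Q θ φ - ∑ i ∈ I.filter (fun i => X i < -1 + a), inner2 Q (Ψ i) * Ψ i θ φ)
      = fun θ φ => ∑ i ∈ I.filter (fun i => ¬ X i < -1 + a), c i * Ψ i θ φ := by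
    funext θ φ
    rw [Finset.sum_congr rfl fun i hi => by rw [hcoef i (Finset.mem_filter.1 hi).1]]
    rw [hQ]
    beta_reduce
    rw [← Finset.sum_filter_add_sum_filter_not I (fun i => X i < -1 + a) (fun i => c i * Ψ i θ φ)]
    ring
  have hX : ∀ i ∈ I, 0 ≤ 1 + X i := by
    intro i hi
    have h := eps_lower (Ψ i) (hc i hi)
    have h2 := eps_eq (Ψ i)
    rw [he i hi i hi, ho i hi i hi] at h2
    rw [ho i hi i hi] at h
    simp only [if_true, mul_one, Complex.one_re] at h h2
    have h3 : eps (Ψ i) = X i := by exact_mod_cast h2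
    linarith
  have hnorm : ∑ i ∈ I, ‖c i‖ ^ 2 = 1 := by
    have h1 := key I subset_rfl
    rw [← hQ] at h1
    unfold norm2 at hn
    rw [h1, Complex.ofReal_re, Real.sqrt_eq_one] at hn
    exact hn
  have heps : eps Q = ∑ i ∈ I, X i * ‖c i‖ ^ 2 := by
    have h := eps_eq Q
    have hM : Mop Q = fun θ φ => ∑ i ∈ I, c i * Mop (Ψ i) θ φ := by
      funext θ φ
      rw [hQ]; simp only [Mop]; rw [Finset.mul_sum]
      exact Finset.sum_congr rfl fun i _ => by ring
    have hQc : Cont Q := by rw [hQ]; exact cont_sum I c Ψ hc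
    rw [hM, inner2_sum_left I c _ Q (fun i hi => cont_Mop (hc i hi)) hQc] at h
    have : ∀ i ∈ I, c i * inner2 (Mop (Ψ i)) Q = ((X i * ‖c i‖ ^ 2 : ℝ) : ℂ) := by
      intro i hi
      have e : inner2 (Mop (Ψ i)) Q = ∑ j ∈ I, (starRingEnd ℂ) (c j) * inner2 (Mop (Ψ i)) (Ψ j) := by
        rw [hQ]; exact inner2_sum_right I c Ψ _ hc (cont_Mop (hc i hi))
      rw [e, Finset.sum_congr rfl fun j hj => by rw [he i hi j hj, ho i hi j hj]]
      simp only [mul_ite, mul_one, mul_zero, Finset.sum_ite_eq, hi, if_true]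
      rw [← mul_assoc, Complex.mul_conj, Complex.normSq_eq_norm_sq]
      push_cast; ring
    rw [Finset.sum_congr rfl this] at h
    exact_mod_cast h
  rw [hdiff]
  unfold norm2
  rw [Real.sq_sqrt (inner2_self_re_nonneg _), key _ (Finset.filter_subset _ _), Complex.ofReal_re,
    le_div_iff₀ ha, heps, Finset.sum_mul]
  have hsum : 1 + ∑ i ∈ I, X i * ‖c i‖ ^ 2 = ∑ i ∈ I, (‖c i‖ ^ 2 + X i * ‖c i‖ ^ 2) := by
    rw [Finset.sum_add_distrib, hnorm]
  rw [hsum]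
  calc ∑ i ∈ I.filter (fun i => ¬ X i < -1 + a), ‖c i‖ ^ 2 * a
      ≤ ∑ i ∈ I.filter (fun i => ¬ X i < -1 + a), (‖c i‖ ^ 2 + X i * ‖c i‖ ^ 2) := by
        refine Finset.sum_le_sum fun i hi => ?_
        have := (Finset.mem_filter.1 hi).2
        nlinarith [sq_nonneg ‖c i‖]
    _ ≤ _ := by
        refine Finset.sum_le_sum_of_subset_of_nonneg (Finset.filter_subset _ _) fun i hi _ => ?_
        have := hX i hi
        nlinarith [sq_nonneg ‖c i‖]

/-- normalized coefficients -/
def V (n m k : ℕ) (x : ℝ) (j : ℕ) : ℝ := kap n m k x * pA k (m - k) j x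

lemma kap_eq (n m k : ℕ) (x : ℝ) (hk : k ≤ n) (hm : m ≤ n) :
    kap n m k x = (Real.sqrt (∑ j ∈ range (Nk n m k), pA k (m-k) j x ^ 2))⁻¹ := by
  unfold kap
  rw [show Finset.Icc (max k m) n = Finset.Ico (max k m) (n+1) by ext; simp,
    Finset.sum_Ico_eq_sum_range, show n + 1 - max k m = Nk n m k by unfold Nk; omega]
  simp

lemma psi_eq (n m : ℕ) (k : ℤ) (x : ℝ) (hk : k.natAbs ≤ n) (hm : m ≤ n) :
    psiFun n m k x = fun θ φ => ∑ j ∈ range (Nk n m k.natAbs), (V n m k.natAbs x j : ℂ) * Z k (m - k.natAbs + j) θ φ := by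
  funext θ φ
  unfold psiFun
  rw [show Finset.Icc (max k.natAbs m) n = Finset.Ico (max k.natAbs m) (n+1) by ext; simp,
    Finset.sum_Ico_eq_sum_range, show n + 1 - max k.natAbs m = Nk n m k.natAbs by unfold Nk; omega,
    Finset.mul_sum]
  refine Finset.sum_congr rfl fun j _ => ?_
  rw [Y_eq, V, show max k.natAbs m + j - max k.natAbs m = j by omega,
    show max k.natAbs m + j - k.natAbs = m - k.natAbs + j by omega]
  push_cast; ring

lemma V_norm (n m k : ℕ) (x : ℝ) (hk : k ≤ n) (hm : m ≤ n) : ∑ j ∈ range (Nk n m k), V n m k x j ^ 2 = 1 := by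
  simp only [V, mul_pow]
  rw [← Finset.mul_sum, kap_eq n m k x hk hm, inv_pow, Real.sq_sqrt (Finset.sum_nonneg fun _ _ => sq_nonneg _)]
  refine inv_mul_cancel₀ (ne_of_gt ?_)
  refine Finset.sum_pos' (fun _ _ => sq_nonneg _) ⟨0, by simp [Nk], ?_⟩
  have := b_pos k (m-k)
  simp only [pA]; positivity

lemma cont_psi (n m : ℕ) (k : ℤ) (x : ℝ) (hk : k.natAbs ≤ n) (hm : m ≤ n) : Cont (psiFun n m k x) := by
  rw [psi_eq n m k x hk hm]
  exact cont_sum _ _ (fun j => Z k (m - k.natAbs + j)) fun j _ => cont_Z _ _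

lemma cont_W (k : ℤ) (s : ℕ) : Cont (W k s) := by
  cases s with
  | zero => exact continuous_const
  | succ s => exact continuous_const.mul (cont_Z k s)

lemma eig_Z (n m : ℕ) (k : ℤ) (x : ℝ) (hk : k.natAbs ≤ n) (hm : m ≤ n)
    (hx : pA k.natAbs (m - k.natAbs) (Nk n m k.natAbs) x = 0) (k' : ℤ) (j : ℕ)
    (hj : j < Nk n m k'.natAbs) :
    inner2 (Mop (psiFun n m k x)) (Z k' (m - k'.natAbs + j)) =
      x * inner2 (psiFun n m k x) (Z k' (m - k'.natAbs + j)) := by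
  set M := m - k.natAbs with hM
  have hN : Nk n m k.natAbs = (Nk n m k.natAbs - 1) + 1 := by unfold Nk; omega
  set N := Nk n m k.natAbs - 1 with hNN
  have e : Mop (psiFun n m k x) = fun θ φ => (x:ℂ) * psiFun n m k x θ φ + 1 *
      ((kap n m k.natAbs x * pA k.natAbs M 0 x : ℂ) * W k M θ φ +
        (kap n m k.natAbs x * b k.natAbs (M+N+1) * pA k.natAbs M N x : ℂ) * Z k (M+N+1) θ φ) := by
    funext θ φ
    have h := CD k M x θ φ N
    rw [hN] at hx
    rw [hx] at h
    have h2 : psiFun n m k x θ φ = (kap n m k.natAbs x : ℂ) *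
        ∑ j ∈ range (N+1), (pA k.natAbs M j x : ℂ) * Z k (M+j) θ φ := by
      rw [psi_eq n m k x hk hm, hN, Finset.mul_sum]
      refine Finset.sum_congr rfl fun j _ => ?_
      rw [V]; push_cast; ring
    simp only [Mop]
    rw [h2]
    push_cast at h ⊢
    linear_combination (kap n m k.natAbs x : ℂ) * h
  have hcW := cont_W k M
  have hcZ := cont_Z k (M+N+1)
  have hcp := cont_psi n m k x hk hm
  have hc' := cont_Z k' (m - k'.natAbs + j)
  have hcs : Cont (fun θ φ => ((kap n m k.natAbs x * pA k.natAbs M 0 x : ℂ) * W k M θ φ +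
        (kap n m k.natAbs x * b k.natAbs (M+N+1) * pA k.natAbs M N x : ℂ) * Z k (M+N+1) θ φ)) :=
    (continuous_const.mul hcW).add (continuous_const.mul hcZ)
  rw [e, inner2_add_left _ _ _ _ _ hcp hcs hc',
    inner2_add_left _ _ _ _ _ hcW hcZ hc']
  have z1 : inner2 (W k M) (Z k' (m - k'.natAbs + j)) = 0 := by
    rcases hMs : M with _ | s
    · simp [W, inner2]
    · have := inner2_add_left (Z k s) (Z k s) (Z k' (m - k'.natAbs + j)) (b k.natAbs (s+1) : ℂ) 0
        (cont_Z _ _) (cont_Z _ _) hc'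
      simp only [zero_mul, add_zero] at this
      rw [W, this, Z_orth, if_neg, mul_zero]
      rintro ⟨rfl, h⟩
      omega
  have z2 : inner2 (Z k (M+N+1)) (Z k' (m - k'.natAbs + j)) = 0 := by
    rw [Z_orth, if_neg]
    rintro ⟨rfl, h⟩
    omega
  rw [z1, z2]; ring

lemma eig_psi (n m : ℕ) (k : ℤ) (x : ℝ) (hk : k.natAbs ≤ n) (hm : m ≤ n)
    (hx : pA k.natAbs (m - k.natAbs) (Nk n m k.natAbs) x = 0) (k' : ℤ) (y : ℝ) (hk' : k'.natAbs ≤ n) :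
    inner2 (Mop (psiFun n m k x)) (psiFun n m k' y) = x * inner2 (psiFun n m k x) (psiFun n m k' y) := by
  have hcp := cont_psi n m k x hk hm
  rw [psi_eq n m k' y hk' hm,
    inner2_sum_right _ _ (fun j => Z k' (m - k'.natAbs + j)) _ (fun j _ => cont_Z _ _) hcp,
    inner2_sum_right _ _ (fun j => Z k' (m - k'.natAbs + j)) _ (fun j _ => cont_Z _ _) (cont_Mop hcp),
    Finset.mul_sum]
  refine Finset.sum_congr rfl fun j hj => ?_
  rw [eig_Z n m k x hk hm hx k' j (Finset.mem_range.1 hj)]; ring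

lemma psi_inner (n m : ℕ) (k : ℤ) (x : ℝ) (hk : k.natAbs ≤ n) (hm : m ≤ n) (k' : ℤ) (y : ℝ) (hk' : k'.natAbs ≤ n) :
    inner2 (psiFun n m k x) (psiFun n m k' y) =
      if k = k' then ((∑ j ∈ range (Nk n m k.natAbs), V n m k.natAbs x j * V n m k.natAbs y j : ℝ) : ℂ) else 0 := by
  rw [psi_eq n m k x hk hm, inner2_sum_left _ _ (fun j => Z k (m - k.natAbs + j)) _ (fun j _ => cont_Z _ _)
    (cont_psi n m k' y hk' hm)]
  have : ∀ j, inner2 (Z k (m - k.natAbs + j)) (psiFun n m k' y) =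
      ∑ j' ∈ range (Nk n m k'.natAbs), (V n m k'.natAbs y j' : ℂ) *
        if k = k' ∧ m - k.natAbs + j = m - k'.natAbs + j' then 1 else 0 := by
    intro j
    rw [psi_eq n m k' y hk' hm, inner2_sum_right _ _ (fun j => Z k' (m - k'.natAbs + j)) _ (fun j _ => cont_Z _ _)
      (cont_Z _ _)]
    refine Finset.sum_congr rfl fun j' _ => ?_
    rw [Z_orth, Complex.conj_ofReal]
  simp only [this]
  split_ifs with h
  · subst h
    push_cast
    refine Finset.sum_congr rfl fun j hj => ?_
    congr 1
    simp only [true_and, add_right_inj, mul_ite, mul_one, mul_zero, Finset.sum_ite_eq, hj, if_true]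
  · simp [h]

lemma psi_orth (n m : ℕ) (k : ℤ) (x y : ℝ) (hk : k.natAbs ≤ n) (hm : m ≤ n)
    (hx : pA k.natAbs (m - k.natAbs) (Nk n m k.natAbs) x = 0)
    (hy : pA k.natAbs (m - k.natAbs) (Nk n m k.natAbs) y = 0) (hxy : x ≠ y) :
    inner2 (psiFun n m k x) (psiFun n m k y) = 0 := by
  have h1 := eig_psi n m k x hk hm hx k y hk
  have h2 := eig_psi n m k y hk hm hy k x hk
  have h3 := congrArg (starRingEnd ℂ) h2
  rw [map_mul, inner2_conj, inner2_conj, Complex.conj_ofReal, ← inner2_Mop, h1] at h3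
  have h4 : ((x - y : ℝ) : ℂ) * inner2 (psiFun n m k x) (psiFun n m k y) = 0 := by
    push_cast; linear_combination h3
  refine (mul_eq_zero.1 h4).resolve_left ?_
  exact_mod_cast sub_ne_zero.2 hxy

lemma mem_span_exists {ι E : Type*} [AddCommGroup E] [Module ℂ E] (I : Finset ι) (Ψ : ι → E) (Q : E)
    (h : Q ∈ Submodule.span ℂ (Ψ '' (I : Set ι))) : ∃ c : ι → ℂ, ∑ i ∈ I, c i • Ψ i = Q := by
  classical
  obtain ⟨c, hc⟩ := (Submodule.mem_span_image_finset_iff_exists_fun ℂ).1 h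
  refine ⟨fun i => if hi : i ∈ I then c ⟨i, hi⟩ else 0, ?_⟩
  rw [← hc, ← Finset.sum_coe_sort I]
  refine Finset.sum_congr rfl fun i _ => ?_
  simp

/-- for `Q ∈ Π_n^m` with `‖Q‖ = 1` and `a > 0`,
`‖Q − Σ_{k} Σ_{i : x_{|k|,i} ∈ [−1,−1+a)} ⟨Q,ψ_{k,i}⟩ ψ_{k,i}‖² ≤ (1+ε(Q))/a`. -/
theorem stmt10 (n m : ℕ) (hmn : m ≤ n) (a : ℝ) (ha : 0 < a) (x : ℕ → ℕ → ℝ)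
    (hroot : ∀ k : ℕ, k ≤ n → ∀ i < Nk n m k, pA (k : ℝ) (m - k) (Nk n m k) (x k i) = 0)
    (hinj : ∀ k : ℕ, k ≤ n → ∀ i < Nk n m k, ∀ j < Nk n m k, x k i = x k j → i = j)
    (Q : ℝ → ℝ → ℂ) (hQ : Q ∈ Pi_nm n m) (hQn : norm2 Q = 1) :
    norm2 (fun θ φ => Q θ φ -
        ∑ k ∈ Finset.Icc (-(n : ℤ)) (n : ℤ),
          ∑ i ∈ (Finset.range (Nk n m k.natAbs)).filter (fun i => x k.natAbs i < -1 + a),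
            inner2 Q (psiFun n m k (x k.natAbs i)) * psiFun n m k (x k.natAbs i) θ φ) ^ 2 ≤
      (1 + eps Q) / a := by
  set I : Finset ((_ : ℤ) × ℕ) := (Finset.Icc (-(n : ℤ)) (n : ℤ)).sigma (fun k => range (Nk n m k.natAbs)) with hI
  let Ψ : ((_ : ℤ) × ℕ) → ℝ → ℝ → ℂ := fun q => psiFun n m q.1 (x q.1.natAbs q.2)
  let X : ((_ : ℤ) × ℕ) → ℝ := fun q => x q.1.natAbs q.2
  have hmem : ∀ q ∈ I, q.1.natAbs ≤ n ∧ q.2 < Nk n m q.1.natAbs := by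
    intro q hq
    rw [hI, Finset.mem_sigma, Finset.mem_Icc, Finset.mem_range] at hq
    exact ⟨by omega, hq.2⟩
  have hc : ∀ q ∈ I, Cont (Ψ q) := fun q hq => cont_psi n m _ _ (hmem q hq).1 hmn
  have ho : ∀ q ∈ I, ∀ r ∈ I, inner2 (Ψ q) (Ψ r) = if q = r then 1 else 0 := by
    rintro ⟨k, i⟩ hq ⟨k', i'⟩ hr
    have h1 := hmem _ hq
    have h2 := hmem _ hr
    simp only at h1 h2
    by_cases hk : k = k'
    · subst hk
      by_cases hi : i = i'
      · subst hi
        have := V_norm n m k.natAbs (x k.natAbs i) h1.1 hmn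
        simp only [Ψ]
        rw [psi_inner n m k _ h1.1 hmn k _ h1.1, if_pos rfl, if_pos trivial]
        simp only [sq] at this
        rw [this]; simp
      · simp only [Ψ]
        rw [psi_orth n m k _ _ h1.1 hmn (hroot _ h1.1 _ h1.2) (hroot _ h1.1 _ h2.2)
          (fun h => hi (hinj _ h1.1 _ h1.2 _ h2.2 h)), if_neg]
        simp [hi]
    · simp only [Ψ]
      rw [psi_inner n m k _ h1.1 hmn k' _ h2.1, if_neg hk, if_neg]
      simp [hk]
  have he : ∀ q ∈ I, ∀ r ∈ I, inner2 (Mop (Ψ q)) (Ψ r) = X q * inner2 (Ψ q) (Ψ r) := by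
    intro q hq r hr
    exact eig_psi n m _ _ (hmem q hq).1 hmn (hroot _ (hmem q hq).1 _ (hmem q hq).2) _ _ (hmem r hr).1
  have hspan : Q ∈ Submodule.span ℂ (Ψ '' (I : Set ((_ : ℤ) × ℕ))) := by
    refine (Submodule.span_le.2 ?_ : Pi_nm n m ≤ _) hQ
    rintro g ⟨l, k, hml, hln, hkl, rfl⟩
    have hkn : k.natAbs ≤ n := hkl.trans hln
    have hIk : ∀ i < Nk n m k.natAbs, (⟨k, i⟩ : (_ : ℤ) × ℕ) ∈ I := by
      intro i hi
      rw [hI, Finset.mem_sigma, Finset.mem_Icc, Finset.mem_range]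
      exact ⟨by constructor <;> simp only <;> omega, hi⟩
    set N := Nk n m k.natAbs with hN
    let U : Matrix (Fin N) (Fin N) ℝ := fun i j => V n m k.natAbs (x k.natAbs i) j
    have hU : U * U.transpose = 1 := by
      ext i i'
      rw [Matrix.mul_apply, Matrix.one_apply]
      have h := ho _ (hIk i i.2) _ (hIk i' i'.2)
      simp only [Ψ] at h
      rw [psi_inner n m k _ hkn hmn k _ hkn, if_pos rfl] at h
      have h' : ∑ j ∈ range N, V n m k.natAbs (x k.natAbs i) j * V n m k.natAbs (x k.natAbs i') j
          = if i = i' then 1 else 0 := by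
        by_cases hi : i = i'
        · subst hi; simp only [if_true] at h ⊢; exact_mod_cast h
        · have : (i:ℕ) ≠ i' := fun h => hi (Fin.ext h)
          simp only [hi, if_false]
          rw [if_neg (by simpa using this)] at h
          exact_mod_cast h
      rw [← h', Finset.sum_range]
      rfl
    have hU' := mul_eq_one_comm.1 hU
    have hj : l - max k.natAbs m < N := by rw [hN]; unfold Nk; omega
    set j : Fin N := ⟨l - max k.natAbs m, hj⟩ with hjdef
    have hY : Y l k = ∑ i : Fin N, (U i j : ℂ) • Ψ ⟨k, i⟩ := by
      have h1 : ∀ i : Fin N, Ψ ⟨k, i⟩ = ∑ j' : Fin N, (U i j' : ℂ) • Z k (m - k.natAbs + j') := by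
        intro i
        simp only [Ψ]
        rw [psi_eq n m k _ hkn hmn]
        funext θ φ
        rw [Finset.sum_range]
        simp [Finset.sum_apply, U]
        rfl
      simp only [h1, Finset.smul_sum, smul_smul]
      rw [Finset.sum_comm]
      simp only [← Finset.sum_smul]
      have h2 : ∀ j' : Fin N, ∑ i, (U i j : ℂ) * (U i j' : ℂ) = if j = j' then 1 else 0 := by
        intro j'
        have := congrFun (congrFun hU' j) j'
        rw [Matrix.mul_apply, Matrix.one_apply] at this
        simp only [Matrix.transpose_apply] at this
        have h3 := congrArg (fun t : ℝ => (t : ℂ)) this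
        push_cast at h3
        rw [h3]
        split_ifs <;> simp
      simp only [h2, ite_smul, one_smul, zero_smul, Finset.sum_ite_eq, Finset.mem_univ, if_true]
      rw [Y_eq, hjdef]
      congr 1
      simp only
      omega
    rw [hY]
    refine Submodule.sum_mem _ fun i _ => Submodule.smul_mem _ _ (Submodule.subset_span ?_)
    exact ⟨_, hIk i i.2, rfl⟩
  obtain ⟨c, hcQ⟩ := mem_span_exists I Ψ Q hspan
  have hQ' : Q = fun θ φ => ∑ i ∈ I, c i * Ψ i θ φ := by
    rw [← hcQ]; funext θ φ; simp [Finset.sum_apply]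
  have := abstract_bound I Ψ X hc ho he Q c hQ' hQn a ha
  convert this using 6 with θ φ
  rw [Finset.sum_filter, hI, Finset.sum_sigma]
  refine Finset.sum_congr rfl fun k _ => ?_
  rw [Finset.sum_filter]
end SFT
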